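/- arXiv:1712.06805 — 2 statements merged into one kernel-verified Lean document; each statement's English description precedes it below -/
import Mathlib

section
/- Let ν : (real N×N matrices) → ℝ be any norm, i.e. ν(X) ≥ 0 for all X, ν(X) = 0 if and only if X = 0, ν(c•X) = |c|·ν(X) for all c ∈ ℝ, and ν(X + Y) ≤ ν(X) + ν(Y). Define μ_n^ν(𝒜,𝒝) = max over A_1,…,A_n ∈ 𝒜 of the min over B_1,…,B_n ∈ 𝒝 of ν(A_n B_n ⋯ A_1 B_1). Then the sequence n ↦ μ_n^ν(𝒜,𝒝)^{1/n} converges, and its limit equals μ(𝒜,𝒝); in particular the limit is independent of the choice of norm. -/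
open Filter

/-- The product `A_n B_n ⋯ A_1 B_1` of the first `n` pairs of factors of two
sequences of matrices (the pair with index `i`, `1 ≤ i ≤ n`, being `A (i-1) * B (i-1)`). -/
def prodAB {N M : ℕ} (A : ℕ → Matrix (Fin N) (Fin M) ℝ)
    (B : ℕ → Matrix (Fin M) (Fin N) ℝ) : ℕ → Matrix (Fin N) (Fin N) ℝ
  | 0 => 1
  | n + 1 => (A n * B n) * prodAB A B n

/-- The product `A_n B_n ⋯ A_1 B_1` for collections of matrices indexed by `Fin n`. -/
def prodABFin {N M n : ℕ} (A : Fin n → Matrix (Fin N) (Fin M) ℝ)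
    (B : Fin n → Matrix (Fin M) (Fin N) ℝ) : Matrix (Fin N) (Fin N) ℝ :=
  (List.ofFn fun i => A i * B i).reverse.prod

/-- `μ_n(𝒜,𝒝)`: the max over all choices `A_1,…,A_n ∈ 𝒜` of the min over all
choices `B_1,…,B_n ∈ 𝒝` of `ν (A_n B_n ⋯ A_1 B_1)`, where `ν` is a norm on
`N×N` matrices. -/
noncomputable def muN {N M : ℕ} (𝒜 : Finset (Matrix (Fin N) (Fin M) ℝ))
    (𝒝 : Finset (Matrix (Fin M) (Fin N) ℝ)) (hA : 𝒜.Nonempty) (hB : 𝒝.Nonempty)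
    (ν : Matrix (Fin N) (Fin N) ℝ → ℝ) (n : ℕ) : ℝ :=
  haveI : Nonempty {A // A ∈ 𝒜} := ⟨⟨hA.choose, hA.choose_spec⟩⟩
  haveI : Nonempty {B // B ∈ 𝒝} := ⟨⟨hB.choose, hB.choose_spec⟩⟩
  Finset.univ.sup' Finset.univ_nonempty fun A : Fin n → {A // A ∈ 𝒜} =>
    Finset.univ.inf' Finset.univ_nonempty fun B : Fin n → {B // B ∈ 𝒝} =>
      ν (prodABFin (fun i => (A i : Matrix (Fin N) (Fin M) ℝ))
          (fun i => (B i : Matrix (Fin M) (Fin N) ℝ)))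

/-- `η_n(𝒜,𝒝)`: the min over all choices `B_1,…,B_n ∈ 𝒝` of the max over all
choices `A_1,…,A_n ∈ 𝒜` of `ν (A_n B_n ⋯ A_1 B_1)`, where `ν` is a norm on
`N×N` matrices. -/
noncomputable def etaN {N M : ℕ} (𝒜 : Finset (Matrix (Fin N) (Fin M) ℝ))
    (𝒝 : Finset (Matrix (Fin M) (Fin N) ℝ)) (hA : 𝒜.Nonempty) (hB : 𝒝.Nonempty)
    (ν : Matrix (Fin N) (Fin N) ℝ → ℝ) (n : ℕ) : ℝ :=
  haveI : Nonempty {A // A ∈ 𝒜} := ⟨⟨hA.choose, hA.choose_spec⟩⟩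
  haveI : Nonempty {B // B ∈ 𝒝} := ⟨⟨hB.choose, hB.choose_spec⟩⟩
  Finset.univ.inf' Finset.univ_nonempty fun B : Fin n → {B // B ∈ 𝒝} =>
    Finset.univ.sup' Finset.univ_nonempty fun A : Fin n → {A // A ∈ 𝒜} =>
      ν (prodABFin (fun i => (A i : Matrix (Fin N) (Fin M) ℝ))
          (fun i => (B i : Matrix (Fin M) (Fin N) ℝ)))

/-- The lower minimax joint spectral radius `μ(𝒜,𝒝) = inf_{n ≥ 1} μ_n(𝒜,𝒝)^{1/n}`. -/
noncomputable def muJSR {N M : ℕ} (𝒜 : Finset (Matrix (Fin N) (Fin M) ℝ))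
    (𝒝 : Finset (Matrix (Fin M) (Fin N) ℝ)) (hA : 𝒜.Nonempty) (hB : 𝒝.Nonempty)
    (ν : Matrix (Fin N) (Fin N) ℝ → ℝ) : ℝ :=
  ⨅ n : ℕ, muN 𝒜 𝒝 hA hB ν (n + 1) ^ (1 / ((n : ℝ) + 1))

/-- The upper minimax joint spectral radius `η(𝒜,𝒝) = inf_{n ≥ 1} η_n(𝒜,𝒝)^{1/n}`. -/
noncomputable def etaJSR {N M : ℕ} (𝒜 : Finset (Matrix (Fin N) (Fin M) ℝ))
    (𝒝 : Finset (Matrix (Fin M) (Fin N) ℝ)) (hA : 𝒜.Nonempty) (hB : 𝒝.Nonempty)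
    (ν : Matrix (Fin N) (Fin N) ℝ → ℝ) : ℝ :=
  ⨅ n : ℕ, etaN 𝒜 𝒝 hA hB ν (n + 1) ^ (1 / ((n : ℝ) + 1))

/-- Fekete's lemma for submultiplicative sequences of nonnegative reals. -/
theorem tendsto_rpow_inv_of_submultiplicative {u : ℕ → ℝ} (h0 : ∀ n, 0 ≤ u n)
    (hmul : ∀ m n, u (m + n) ≤ u m * u n) :
    Tendsto (fun n : ℕ => u n ^ (1 / (n : ℝ))) atTop
      (nhds (⨅ n : ℕ, u (n + 1) ^ (1 / ((n : ℝ) + 1)))) := by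
  have hbdd : BddBelow (Set.range fun n : ℕ => u (n + 1) ^ (1 / ((n : ℝ) + 1))) :=
    ⟨0, by rintro _ ⟨n, rfl⟩; exact Real.rpow_nonneg (h0 _) _⟩
  refine tendsto_order.2 ⟨fun a ha => ?_, fun a ha => ?_⟩
  · filter_upwards [eventually_ge_atTop 1] with n hn
    obtain ⟨m, rfl⟩ := Nat.exists_eq_add_of_le' hn
    have := ciInf_le hbdd m
    push_cast
    exact ha.trans_le this
  · obtain ⟨k, hk⟩ := exists_lt_of_ciInf_lt ha
    have ha0 : 0 < a := (Real.rpow_nonneg (h0 _) _).trans_lt hk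
    by_cases hz : ∃ m, u m = 0
    · obtain ⟨m, hm⟩ := hz
      filter_upwards [eventually_ge_atTop (m + 1)] with n hn
      obtain ⟨j, rfl⟩ := Nat.exists_eq_add_of_le ((Nat.le_succ m).trans hn)
      have hu : u (m + j) = 0 :=
        le_antisymm ((hmul m j).trans_eq (by rw [hm, zero_mul])) (h0 _)
      have hne : (1 / ((m + j : ℕ) : ℝ)) ≠ 0 :=
        one_div_ne_zero (Nat.cast_ne_zero.2 (by omega))
      rwa [hu, Real.zero_rpow hne]
    · push Not at hz
      have hpos : ∀ n, 0 < u n := fun n => (h0 n).lt_of_ne' (hz n)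
      have hsub : Subadditive fun n => Real.log (u n) := fun m n => by
        rw [← Real.log_mul (hz m) (hz n)]
        exact Real.log_le_log (hpos _) (hmul m n)
      have key : ∀ n, u n ^ (1 / (n : ℝ)) < a ↔ Real.log (u n) / n < Real.log a := fun n => by
        rw [← Real.log_lt_log_iff (Real.rpow_pos_of_pos (hpos n) _) ha0,
          Real.log_rpow (hpos n), one_div_mul_eq_div]
      simp only [key]
      refine hsub.eventually_div_lt_of_div_lt k.succ_ne_zero ((key _).1 ?_)
      exact_mod_cast hk

/-- Any two norms on a finite-dimensional real vector space are equivalent. -/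
theorem exists_pos_forall_le_mul_of_norms {E : Type*} [AddCommGroup E] [Module ℝ E]
    [FiniteDimensional ℝ E] {p q : E → ℝ}
    (hp_nonneg : ∀ x, 0 ≤ p x) (hp_zero : ∀ x, p x = 0 ↔ x = 0)
    (hp_smul : ∀ (c : ℝ) x, p (c • x) = |c| * p x) (hp_add : ∀ x y, p (x + y) ≤ p x + p y)
    (hq_nonneg : ∀ x, 0 ≤ q x) (hq_zero : ∀ x, q x = 0 ↔ x = 0)
    (hq_smul : ∀ (c : ℝ) x, q (c • x) = |c| * q x) (hq_add : ∀ x y, q (x + y) ≤ q x + q y) :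
    ∃ C : ℝ, 0 < C ∧ ∀ x, p x ≤ C * q x := by
  have bound : ∀ {F G : Type _} [NormedAddCommGroup F] [NormedSpace ℝ F]
      [NormedAddCommGroup G] [NormedSpace ℝ G] [FiniteDimensional ℝ F] (f : F →ₗ[ℝ] G),
      ∃ C : ℝ, 0 < C ∧ ∀ x, ‖f x‖ ≤ C * ‖x‖ := fun f =>
    (LinearMap.toContinuousLinearMap f).bound
  have hp : @NormedSpace.Core ℝ E _ _ _ ⟨p⟩ :=
    let _ : Norm E := ⟨p⟩
    { norm_nonneg := hp_nonneg, norm_smul := hp_smul, norm_triangle := hp_add,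
      norm_eq_zero_iff := hp_zero }
  have hq : @NormedSpace.Core ℝ E _ _ _ ⟨q⟩ :=
    let _ : Norm E := ⟨q⟩
    { norm_nonneg := hq_nonneg, norm_smul := hq_smul, norm_triangle := hq_add,
      norm_eq_zero_iff := hq_zero }
  let P := @NormedAddCommGroup.ofCore ℝ E _ _ _ ⟨p⟩ hp
  let Q := @NormedAddCommGroup.ofCore ℝ E _ _ _ ⟨q⟩ hq
  exact @bound E E Q (@NormedSpace.ofCore ℝ E _ Q.toSeminormedAddCommGroup _ hq)
    P (@NormedSpace.ofCore ℝ E _ P.toSeminormedAddCommGroup _ hp)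
    ‹FiniteDimensional ℝ E› LinearMap.id

theorem prodABFin_add {N M m n : ℕ} (A : Fin (m + n) → Matrix (Fin N) (Fin M) ℝ)
    (B : Fin (m + n) → Matrix (Fin M) (Fin N) ℝ) :
    prodABFin A B =
      prodABFin (fun i => A (Fin.natAdd m i)) (fun i => B (Fin.natAdd m i)) *
        prodABFin (fun i => A (Fin.castAdd n i)) (fun i => B (Fin.castAdd n i)) := by
  rw [prodABFin, List.ofFn_add, List.reverse_append, List.prod_append]
  rfl

section muN

variable {N M : ℕ} {𝒜 : Finset (Matrix (Fin N) (Fin M) ℝ)}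
  {𝒝 : Finset (Matrix (Fin M) (Fin N) ℝ)} (hA : 𝒜.Nonempty) (hB : 𝒝.Nonempty)
  {ν ν' : Matrix (Fin N) (Fin N) ℝ → ℝ}

theorem muN_le_iff {n : ℕ} {c : ℝ} :
    muN 𝒜 𝒝 hA hB ν n ≤ c ↔ ∀ A : Fin n → {A // A ∈ 𝒜}, ∃ B : Fin n → {B // B ∈ 𝒝},
      ν (prodABFin (fun i => (A i : Matrix (Fin N) (Fin M) ℝ))
        (fun i => (B i : Matrix (Fin M) (Fin N) ℝ))) ≤ c := by
  simp [muN, Finset.sup'_le_iff, Finset.inf'_le_iff]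

theorem muN_nonneg (hν : ∀ X, 0 ≤ ν X) (n : ℕ) : 0 ≤ muN 𝒜 𝒝 hA hB ν n := by
  obtain ⟨B, hB'⟩ := (muN_le_iff hA hB (ν := ν) (n := n)).1 le_rfl
    fun _ => ⟨hA.choose, hA.choose_spec⟩
  exact (hν _).trans hB'

theorem muN_le_mul {C : ℝ} (hC : 0 ≤ C) (h : ∀ X, ν' X ≤ C * ν X) (n : ℕ) :
    muN 𝒜 𝒝 hA hB ν' n ≤ C * muN 𝒜 𝒝 hA hB ν n := by
  refine (muN_le_iff hA hB).2 fun A => ?_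
  obtain ⟨B, hB'⟩ := (muN_le_iff hA hB (ν := ν)).1 le_rfl A
  exact ⟨B, (h _).trans (mul_le_mul_of_nonneg_left hB' hC)⟩

theorem muN_add_le (hν : ∀ X, 0 ≤ ν X) (hν_mul : ∀ X Y, ν (X * Y) ≤ ν X * ν Y) (m n : ℕ) :
    muN 𝒜 𝒝 hA hB ν (m + n) ≤ muN 𝒜 𝒝 hA hB ν m * muN 𝒜 𝒝 hA hB ν n := by
  refine (muN_le_iff hA hB).2 fun A => ?_
  obtain ⟨B₁, h₁⟩ := (muN_le_iff hA hB (ν := ν)).1 le_rfl fun i => A (Fin.castAdd n i)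
  obtain ⟨B₂, h₂⟩ := (muN_le_iff hA hB (ν := ν)).1 le_rfl fun i => A (Fin.natAdd m i)
  refine ⟨Fin.append B₁ B₂, ?_⟩
  rw [prodABFin_add, mul_comm (muN _ _ _ _ _ m)]
  simp only [Fin.append_left, Fin.append_right]
  exact (hν_mul _ _).trans (mul_le_mul h₂ h₁ (hν _) (muN_nonneg hA hB hν n))

end muN

/-- Let `‖·‖ = ν` be the operator norm on `N×N` matrices induced
by a vector norm on `ℝ^N` (in particular a norm with `ν (X*Y) ≤ ν X * ν Y`),
defining `μ(𝒜,𝒝) = inf_{n ≥ 1} μ_n(𝒜,𝒝)^{1/n}`.  Let `ν'` be *any* norm on the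
space of `N×N` real matrices: `ν' X ≥ 0`, `ν' X = 0 ↔ X = 0`,
`ν' (c • X) = |c| * ν' X` and `ν' (X + Y) ≤ ν' X + ν' Y`, and let `μ_n^{ν'}` be
defined as `μ_n` but with `ν'` instead of `ν`.  Then `n ↦ μ_n^{ν'}(𝒜,𝒝)^{1/n}`
converges, and its limit equals `μ(𝒜,𝒝)`; in particular the limit does not
depend on the choice of the norm. -/
theorem muN_pow_inv_tendsto_of_norm {N M : ℕ} (𝒜 : Finset (Matrix (Fin N) (Fin M) ℝ))
    (𝒝 : Finset (Matrix (Fin M) (Fin N) ℝ)) (hA : 𝒜.Nonempty) (hB : 𝒝.Nonempty)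
    (ν : Matrix (Fin N) (Fin N) ℝ → ℝ)
    (hν_zero : ∀ X : Matrix (Fin N) (Fin N) ℝ, ν X = 0 ↔ X = 0)
    (hν_smul : ∀ (c : ℝ) (X : Matrix (Fin N) (Fin N) ℝ), ν (c • X) = |c| * ν X)
    (hν_add : ∀ X Y : Matrix (Fin N) (Fin N) ℝ, ν (X + Y) ≤ ν X + ν Y)
    (hν_mul : ∀ X Y : Matrix (Fin N) (Fin N) ℝ, ν (X * Y) ≤ ν X * ν Y)
    (ν' : Matrix (Fin N) (Fin N) ℝ → ℝ)
    (hν'_nonneg : ∀ X : Matrix (Fin N) (Fin N) ℝ, 0 ≤ ν' X)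
    (hν'_zero : ∀ X : Matrix (Fin N) (Fin N) ℝ, ν' X = 0 ↔ X = 0)
    (hν'_smul : ∀ (c : ℝ) (X : Matrix (Fin N) (Fin N) ℝ), ν' (c • X) = |c| * ν' X)
    (hν'_add : ∀ X Y : Matrix (Fin N) (Fin N) ℝ, ν' (X + Y) ≤ ν' X + ν' Y) :
    Tendsto (fun n : ℕ => muN 𝒜 𝒝 hA hB ν' n ^ (1 / (n : ℝ))) atTop
      (nhds (muJSR 𝒜 𝒝 hA hB ν)) := by
  have hν_nonneg (X : Matrix (Fin N) (Fin N) ℝ) : 0 ≤ ν X := by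
    have h := hν_add X ((-1 : ℝ) • X)
    rw [hν_smul, neg_one_smul, add_neg_cancel, (hν_zero 0).2 rfl, abs_neg, abs_one, one_mul] at h
    linarith
  obtain ⟨C, hC, hνC⟩ := exists_pos_forall_le_mul_of_norms hν'_nonneg hν'_zero hν'_smul hν'_add
    hν_nonneg hν_zero hν_smul hν_add
  obtain ⟨D, hD, hνD⟩ := exists_pos_forall_le_mul_of_norms hν_nonneg hν_zero hν_smul hν_add
    hν'_nonneg hν'_zero hν'_smul hν'_add
  have hμ := tendsto_rpow_inv_of_submultiplicative (muN_nonneg hA hB hν_nonneg)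
    (muN_add_le hA hB hν_nonneg hν_mul)
  have hconst {c : ℝ} (hc : 0 < c) :
      Tendsto (fun n : ℕ => (c * muN 𝒜 𝒝 hA hB ν n) ^ (1 / (n : ℝ))) atTop
        (nhds (muJSR 𝒜 𝒝 hA hB ν)) := by
    have hroot : Tendsto (fun n : ℕ => c ^ (1 / (n : ℝ))) atTop (nhds 1) := by
      simpa [Function.comp_def] using
        (Real.continuousAt_const_rpow hc.ne').tendsto.comp tendsto_one_div_atTop_nhds_zero_nat
    simpa only [Real.mul_rpow hc.le (muN_nonneg hA hB hν_nonneg _), one_mul, muJSR]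
      using hroot.mul hμ
  refine tendsto_of_tendsto_of_tendsto_of_le_of_le (hconst (inv_pos.2 hD)) (hconst hC)
    (fun n => ?_) (fun n => ?_)
  · refine Real.rpow_le_rpow
      (mul_nonneg (inv_pos.2 hD).le (muN_nonneg hA hB hν_nonneg n)) ?_ (by positivity)
    rw [inv_mul_le_iff₀ hD]
    exact muN_le_mul hA hB hD.le hνD n
  · exact Real.rpow_le_rpow (muN_nonneg hA hB hν'_nonneg n)
      (muN_le_mul hA hB hC.le hνC n) (by positivity)
end

section
/- The following are equivalent: (i) there exists a sequence (A_n)_{n≥1} with A_n ∈ 𝒜 such that ‖A_n ⋯ A_1‖ → 0 as n → ∞ (uniform stabilizability); (ii) ρ̌(𝒜) < 1. -/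
open Filter

/-- The product `A_n ⋯ A_1` of the first `n` factors of a sequence of square
matrices (the factor with index `i`, `1 ≤ i ≤ n`, being `A (i-1)`). -/
def prodA {N : ℕ} (A : ℕ → Matrix (Fin N) (Fin N) ℝ) : ℕ → Matrix (Fin N) (Fin N) ℝ
  | 0 => 1
  | n + 1 => A n * prodA A n

/-- The product `A_n ⋯ A_1` for a collection of square matrices indexed by `Fin n`. -/
def prodAFin {N n : ℕ} (A : Fin n → Matrix (Fin N) (Fin N) ℝ) : Matrix (Fin N) (Fin N) ℝ :=
  (List.ofFn A).reverse.prod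

/-- The joint spectral radius `ρ(𝒜) = inf_{n ≥ 1} (max_{A_i ∈ 𝒜} ν (A_n ⋯ A_1))^{1/n}`,
computed with respect to a norm `ν` on `N×N` matrices. -/
noncomputable def jointSR {N : ℕ} (𝒜 : Finset (Matrix (Fin N) (Fin N) ℝ)) (hA : 𝒜.Nonempty)
    (ν : Matrix (Fin N) (Fin N) ℝ → ℝ) : ℝ :=
  haveI : Nonempty {A // A ∈ 𝒜} := ⟨⟨hA.choose, hA.choose_spec⟩⟩
  ⨅ n : ℕ,
    (Finset.univ.sup' Finset.univ_nonempty fun A : Fin (n + 1) → {A // A ∈ 𝒜} =>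
        ν (prodAFin fun i => (A i : Matrix (Fin N) (Fin N) ℝ))) ^ (1 / ((n : ℝ) + 1))

/-- The lower spectral radius `ρ̌(𝒜) = inf_{n ≥ 1} (min_{A_i ∈ 𝒜} ν (A_n ⋯ A_1))^{1/n}`,
computed with respect to a norm `ν` on `N×N` matrices. -/
noncomputable def lowerSR {N : ℕ} (𝒜 : Finset (Matrix (Fin N) (Fin N) ℝ)) (hA : 𝒜.Nonempty)
    (ν : Matrix (Fin N) (Fin N) ℝ → ℝ) : ℝ :=
  haveI : Nonempty {A // A ∈ 𝒜} := ⟨⟨hA.choose, hA.choose_spec⟩⟩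
  ⨅ n : ℕ,
    (Finset.univ.inf' Finset.univ_nonempty fun A : Fin (n + 1) → {A // A ∈ 𝒜} =>
        ν (prodAFin fun i => (A i : Matrix (Fin N) (Fin N) ℝ))) ^ (1 / ((n : ℝ) + 1))

theorem prodAFin_eq_prodA {N : ℕ} (A : ℕ → Matrix (Fin N) (Fin N) ℝ) (n : ℕ) :
    prodAFin (fun i : Fin n => A i) = prodA A n := by
  induction n with
  | zero => simp [prodAFin, prodA]
  | succ n ih =>
    rw [prodA, ← ih, prodAFin, List.ofFn_succ']
    simp [prodAFin]

theorem prodA_add {N : ℕ} (A : ℕ → Matrix (Fin N) (Fin N) ℝ) (m n : ℕ) :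
    prodA A (m + n) = prodA (fun i => A (m + i)) n * prodA A m := by
  induction n with
  | zero => simp [prodA]
  | succ n ih => rw [← add_assoc, prodA, ih, prodA, mul_assoc]

theorem prodA_add_mul_of_periodic {N : ℕ} {A : ℕ → Matrix (Fin N) (Fin N) ℝ} {p : ℕ}
    (hA : Function.Periodic A p) (r q : ℕ) :
    prodA A (r + p * q) = prodA A r * prodA A p ^ q := by
  induction q with
  | zero => simp
  | succ q ih =>
    have h_shift : (fun i => A (p + i)) = A := funext fun i => by rw [add_comm, hA i]
    rw [show r + p * (q + 1) = p + (r + p * q) by ring, prodA_add, h_shift, ih, pow_succ,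
      mul_assoc]

theorem map_mul_pow_le {M : Type*} [Monoid M] {f : M → ℝ} (hf : ∀ x, 0 ≤ f x)
    (hmul : ∀ x y, f (x * y) ≤ f x * f y) (x y : M) (q : ℕ) :
    f (x * y ^ q) ≤ f x * f y ^ q := by
  induction q with
  | zero => simp
  | succ q ih =>
    rw [pow_succ, pow_succ, ← mul_assoc, ← mul_assoc]
    exact (hmul _ _).trans (mul_le_mul_of_nonneg_right ih (hf y))

theorem tendsto_prodA_of_periodic {N : ℕ} {A : ℕ → Matrix (Fin N) (Fin N) ℝ} {p : ℕ}
    (hp : p ≠ 0) (hA : Function.Periodic A p) {ν : Matrix (Fin N) (Fin N) ℝ → ℝ}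
    (hν : ∀ X, 0 ≤ ν X) (hmul : ∀ X Y, ν (X * Y) ≤ ν X * ν Y) (hlt : ν (prodA A p) < 1) :
    Tendsto (fun n => ν (prodA A n)) atTop (nhds 0) := by
  have h_lim : Tendsto
      (fun n => (∑ r ∈ Finset.range p, ν (prodA A r)) * ν (prodA A p) ^ (n / p))
      atTop (nhds 0) := by
    simpa using ((tendsto_pow_atTop_nhds_zero_of_lt_one (hν _) hlt).comp
      (Nat.tendsto_div_const_atTop hp)).const_mul (∑ r ∈ Finset.range p, ν (prodA A r))
  refine squeeze_zero (fun n => hν _) (fun n => ?_) h_lim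
  calc ν (prodA A n) = ν (prodA A (n % p) * prodA A p ^ (n / p)) := by
        rw [← prodA_add_mul_of_periodic hA, Nat.mod_add_div]
    _ ≤ ν (prodA A (n % p)) * ν (prodA A p) ^ (n / p) := map_mul_pow_le hν hmul _ _ _
    _ ≤ _ := mul_le_mul_of_nonneg_right
        (Finset.single_le_sum (f := fun r => ν (prodA A r)) (fun r _ => hν _)
          (Finset.mem_range.2 (Nat.mod_lt n (Nat.pos_of_ne_zero hp))))
        (pow_nonneg (hν _) _)

theorem lowerSR_lt_one_iff {N : ℕ} (𝒜 : Finset (Matrix (Fin N) (Fin N) ℝ)) (hA : 𝒜.Nonempty)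
    {ν : Matrix (Fin N) (Fin N) ℝ → ℝ} (hν : ∀ X, 0 ≤ ν X) :
    lowerSR 𝒜 hA ν < 1 ↔ ∃ (n : ℕ) (B : Fin (n + 1) → {A // A ∈ 𝒜}),
      ν (prodAFin fun i => (B i : Matrix (Fin N) (Fin N) ℝ)) < 1 := by
  have : Nonempty {A // A ∈ 𝒜} := hA.to_subtype
  have h_nonneg (n : ℕ) : 0 ≤ Finset.univ.inf' Finset.univ_nonempty
      fun B : Fin (n + 1) → {A // A ∈ 𝒜} =>
        ν (prodAFin fun i => (B i : Matrix (Fin N) (Fin N) ℝ)) :=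
    Finset.le_inf' _ _ fun B _ => hν _
  have h_bdd : BddBelow (Set.range fun n : ℕ => (Finset.univ.inf' Finset.univ_nonempty
      fun B : Fin (n + 1) → {A // A ∈ 𝒜} =>
        ν (prodAFin fun i => (B i : Matrix (Fin N) (Fin N) ℝ))) ^ (1 / ((n : ℝ) + 1))) :=
    ⟨0, Set.forall_mem_range.2 fun n => Real.rpow_nonneg (h_nonneg n) _⟩
  unfold lowerSR
  rw [ciInf_lt_iff h_bdd]
  refine exists_congr fun n => ?_
  rw [Real.rpow_lt_one_iff' (h_nonneg n) (by positivity)]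
  simp [Finset.inf'_lt_iff]

/-- **uniform stabilizability.** Let `ν` be the operator norm on
`N×N` matrices induced by a vector norm on `ℝ^N` (a norm with
`ν (X*Y) ≤ ν X * ν Y`).  The following are equivalent: there exists a sequence
`(A_n) ⊆ 𝒜` with `ν (A_n ⋯ A_1) → 0` as `n → ∞`  ⟺  `ρ̌(𝒜) < 1`. -/
theorem uniformlyStabilizable_iff_lowerSR_lt_one {N : ℕ}
    (𝒜 : Finset (Matrix (Fin N) (Fin N) ℝ)) (hA : 𝒜.Nonempty)
    (ν : Matrix (Fin N) (Fin N) ℝ → ℝ)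
    (hν_zero : ∀ X : Matrix (Fin N) (Fin N) ℝ, ν X = 0 ↔ X = 0)
    (hν_smul : ∀ (c : ℝ) (X : Matrix (Fin N) (Fin N) ℝ), ν (c • X) = |c| * ν X)
    (hν_add : ∀ X Y : Matrix (Fin N) (Fin N) ℝ, ν (X + Y) ≤ ν X + ν Y)
    (hν_mul : ∀ X Y : Matrix (Fin N) (Fin N) ℝ, ν (X * Y) ≤ ν X * ν Y) :
    (∃ A : ℕ → Matrix (Fin N) (Fin N) ℝ, (∀ n, A n ∈ 𝒜) ∧
        Filter.Tendsto (fun n => ν (prodA A n)) atTop (nhds 0)) ↔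
      lowerSR 𝒜 hA ν < 1 := by
  have hν (X : Matrix (Fin N) (Fin N) ℝ) : 0 ≤ ν X := by
    have h := hν_add X ((-1 : ℝ) • X)
    have h_zero : X + (-1 : ℝ) • X = 0 := by simp
    rw [h_zero, (hν_zero 0).2 rfl, hν_smul] at h
    norm_num at h
    linarith
  rw [lowerSR_lt_one_iff 𝒜 hA hν]
  constructor
  · rintro ⟨A, hmem, hlim⟩
    obtain ⟨n, hn⟩ := (((tendsto_add_atTop_iff_nat 1).2 hlim).eventually_lt_const
      one_pos).exists
    exact ⟨n, fun i => ⟨A i, hmem i⟩, by simpa only [prodAFin_eq_prodA A] using hn⟩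
  · rintro ⟨n, B, hB⟩
    let A : ℕ → Matrix (Fin N) (Fin N) ℝ := fun k => B (Fin.ofNat (n + 1) k)
    have h_per : Function.Periodic A (n + 1) := fun k => by
      simp [A, Fin.ofNat]
    have h_eq : prodA A (n + 1) = prodAFin fun i => (B i : Matrix (Fin N) (Fin N) ℝ) := by
      rw [← prodAFin_eq_prodA]
      simp [A]
    exact ⟨A, fun k => (B _).2,
      tendsto_prodA_of_periodic n.succ_ne_zero h_per hν hν_mul (h_eq ▸ hB)⟩
end
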